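/- Let T be an expanding Markov map with repeller Λ and let f : Λ → ℝ be a potential satisfying the tempered distortion condition. Then P(f) = sup{P_F(f) : F ⊆ A is a finite set}, where P_F(f) denotes the pressure computed over the subsystem with alphabet F, i.e. P_F(f) := lim_{n→∞} (1/n) log Σ_{ω∈F^n} exp(S_n(f)(ω)). -/

import Mathlib

open Set Filter Topology

/-- An expanding Markov map with countably many inverse branches: a countable family
`{V i}` of pairwise disjoint subintervals of `[0,1]` with nonempty interior, and a map `T`
(given here as a global function `ℝ → ℝ`, only its behaviour on `⋃ i, V i` matters) which is
`C¹` on each `V i` with derivative `T'`, maps the interior of each `V i` onto `(0,1)`, is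
uniformly expanding, and has tempered distortion of the derivative. -/
structure ExpandingMarkovMap (A : Type) : Type where
  countable : Countable A
  nontriv : ∃ i j : A, i ≠ j
  V : A → Set ℝ
  T : ℝ → ℝ
  T' : ℝ → ℝ
  V_subset : ∀ i, V i ⊆ Icc (0:ℝ) 1
  V_ordConnected : ∀ i, (V i).OrdConnected
  V_interior_nonempty : ∀ i, (interior (V i)).Nonempty
  V_disjoint : Pairwise (Function.onFun Disjoint V)
  T_mapsTo : ∀ i, MapsTo T (V i) (Icc (0:ℝ) 1)
  T_C1 : ∀ i, ContDiffOn ℝ 1 T (V i)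
  T_hasDeriv : ∀ i, ∀ x ∈ V i, HasDerivWithinAt T (T' x) (V i) x
  T_maps_interior : ∀ i, T '' interior (V i) = Ioo (0:ℝ) 1
  expanding : ∃ ξ > (1:ℝ), ∃ N : ℕ, ∀ n, N ≤ n → ∀ ω : Fin n → A, ∀ x : ℝ,
    (∀ ν : Fin n, T^[(ν : ℕ)] x ∈ V (ω ν)) →
    ξ ^ n < ∏ l ∈ Finset.range n, |T' (T^[l] x)|
  distortion : ∃ ρ : ℕ → ℝ, Tendsto ρ atTop (𝓝 0) ∧
    ∀ n : ℕ, ∀ ω : Fin n → A, ∀ x y : ℝ,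
      (∀ ν : Fin n, T^[(ν : ℕ)] x ∈ V (ω ν)) → (∀ ν : Fin n, T^[(ν : ℕ)] y ∈ V (ω ν)) →
      Real.exp (-(n : ℝ) * ρ n) ≤
          (∏ l ∈ Finset.range n, |T' (T^[l] x)|) / (∏ l ∈ Finset.range n, |T' (T^[l] y)|) ∧
        (∏ l ∈ Finset.range n, |T' (T^[l] x)|) / (∏ l ∈ Finset.range n, |T' (T^[l] y)|) ≤
          Real.exp ((n : ℝ) * ρ n)

namespace ExpandingMarkovMap

variable {A : Type} (M : ExpandingMarkovMap A)

/-- The cylinder `V_ω = ⋂_{ν<n} T^{-ν}(V_{ω_ν})` associated to a word `ω ∈ A^n`. -/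
def cylinder {n : ℕ} (ω : Fin n → A) : Set ℝ :=
  {x | ∀ ν : Fin n, M.T^[(ν : ℕ)] x ∈ M.V (ω ν)}

/-- The repeller `Λ`: the set of points all of whose iterates are well defined. -/
def repeller : Set ℝ := {x | ∀ n : ℕ, M.T^[n] x ∈ ⋃ i, M.V i}

/-- The Birkhoff sum `S_n(f)(x) = ∑_{l<n} f(T^l x)`. -/
def birkhoff (f : ℝ → ℝ) (n : ℕ) (x : ℝ) : ℝ := ∑ l ∈ Finset.range n, f (M.T^[l] x)

/-- `S_n(f)(ω) = sup { S_n(f)(x) : x ∈ V_ω }` (`f` being a potential on `Λ`). -/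
noncomputable def birkhoffSup (f : ℝ → ℝ) {n : ℕ} (ω : Fin n → A) : ℝ :=
  sSup {v | ∃ x ∈ M.cylinder ω ∩ M.repeller, v = M.birkhoff f n x}

/-- The set of values `|f x - f y|` over pairs `x, y` in a common `n`-cylinder. -/
def varSet (f : ℝ → ℝ) (n : ℕ) : Set ℝ :=
  {d | ∃ ω : Fin n → A, ∃ x ∈ M.cylinder ω ∩ M.repeller, ∃ y ∈ M.cylinder ω ∩ M.repeller,
    d = |f x - f y|}

/-- The `n`-th level variation `var_n(f)`. -/
noncomputable def var (f : ℝ → ℝ) (n : ℕ) : ℝ := sSup (M.varSet f n)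

/-- The tempered distortion condition for a potential on `Λ`:
`var_1(f) < ∞` and `n⁻¹ var_n(S_n(f)) → 0`. -/
def Tempered (f : ℝ → ℝ) : Prop :=
  BddAbove (M.varSet f 1) ∧
    Tendsto (fun n : ℕ => M.var (M.birkhoff f n) n / (n : ℝ)) atTop (𝓝 0)

/-- The topological pressure `P(f) = lim_n n⁻¹ log ∑_{ω ∈ Aⁿ} exp S_n(f)(ω)`
(realised as a `limsup` in `EReal`; the limit exists for tempered potentials). -/
noncomputable def pressure (f : ℝ → ℝ) : EReal :=
  limsup (fun n : ℕ =>
    ((1 / (n : ℝ) : ℝ) : EReal) *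
      ENNReal.log (∑' ω : Fin n → A, ENNReal.ofReal (Real.exp (M.birkhoffSup f ω)))) atTop

/-- The potential `ψ = log |T'|`. -/
noncomputable def psi : ℝ → ℝ := fun x => Real.log |M.T' x|

/-- `s(φ) = inf { s : P(-s(ψ+φ)) ≤ 0 }`. -/
noncomputable def sdim (φ : ℝ → ℝ) : ℝ :=
  sInf {s : ℝ | M.pressure (fun x => -s * (M.psi x + φ x)) ≤ 0}

/-- The shrinking target set `D_y(φ)`. -/
def shrinkingTarget (y : ℝ) (φ : ℝ → ℝ) : Set ℝ :=
  ⋂ m : ℕ, ⋃ n : ℕ, ⋃ _ : m ≤ n,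
    {x | x ∈ M.repeller ∧ |M.T^[n] x - y| < Real.exp (-(M.birkhoff φ n x))}

/-- The shrinking target set `S_y(Φ)` for a sequence of radii `Φ`. -/
def shrinkingTargetSeq (y : ℝ) (Φ : ℕ → ℝ) : Set ℝ :=
  ⋂ m : ℕ, ⋃ n : ℕ, ⋃ _ : m ≤ n, {x | x ∈ M.repeller ∧ |M.T^[n] x - y| < Φ n}

/-- `g` is the iterated function system associated to `M`: `g i` is the inverse branch of
`T` on `V i`, a `C¹` map of `[0,1]` into `closure (V i)` with `g i (T x) = x` on `V i`. -/
def IsIFS (g : A → ℝ → ℝ) : Prop :=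
  ∀ i, ContDiffOn ℝ 1 (g i) (Icc (0:ℝ) 1) ∧ MapsTo (g i) (Icc (0:ℝ) 1) (closure (M.V i)) ∧
    ∀ x ∈ M.V i, g i (M.T x) = x

end ExpandingMarkovMap

/-- The composition `φ_τ = φ_{τ_1} ∘ ⋯ ∘ φ_{τ_n}` of the maps of an IFS along a word `τ`. -/
def ifsWord {A : Type} (g : A → ℝ → ℝ) {n : ℕ} (τ : Fin n → A) : ℝ → ℝ :=
  (List.ofFn fun ν : Fin n => g (τ ν)).foldr (· ∘ ·) id

/-- `C(y,n,r)`: the collection of cylinder sets `φ_τ([0,1])`, `τ ∈ Aⁿ`, contained in `B(y,r)`. -/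
def cylinderFamily {A : Type} (g : A → ℝ → ℝ) (y : ℝ) (n : ℕ) (r : ℝ) : Set (Set ℝ) :=
  {S | ∃ τ : Fin n → A, S = ifsWord g τ '' Icc (0:ℝ) 1 ∧ S ⊆ Metric.ball y r}

/-- Positive upper cylinder density of the IFS `g` at `y`. -/
def HasPUCD {A : Type} (g : A → ℝ → ℝ) (y : ℝ) : Prop :=
  ∃ lam : ℝ → ℕ,
    Tendsto lam (𝓝[>] (0:ℝ)) atTop ∧
    limsup (fun r : ℝ => Real.log r / (lam r : ℝ)) (𝓝[>] (0:ℝ)) < 0 ∧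
    0 < limsup (fun r : ℝ =>
        (ENNReal.ofReal r)⁻¹ * ∑' S : cylinderFamily g y (lam r) r, EMetric.diam (S : Set ℝ))
      (𝓝[>] (0:ℝ))

/-- Pressure of the subsystem with (finite) alphabet `F ⊆ A`:
`P_F(f) = lim_n n⁻¹ log ∑_{ω ∈ Fⁿ} exp S_n(f)(ω)`. -/
noncomputable def ExpandingMarkovMap.pressureOn {A : Type} (M : ExpandingMarkovMap A)
    (F : Finset A) (f : ℝ → ℝ) : EReal :=
  limsup (fun n : ℕ =>
    ((1 / (n : ℝ) : ℝ) : EReal) *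
      ENNReal.log (∑' ω : Fin n → F, ENNReal.ofReal
        (Real.exp (M.birkhoffSup f fun ν => (ω ν : A))))) atTop

namespace ExpandingMarkovMap

variable {A : Type} (M : ExpandingMarkovMap A)

theorem deriv_ne_zero (i : A) {x : ℝ} (hx : x ∈ M.V i) : M.T' x ≠ 0 := by
  obtain ⟨ρ, -, hρ⟩ := M.distortion
  intro h0
  have h := (hρ 1 (fun _ => i) x x (by simpa using hx) (by simpa using hx)).1
  simp [h0] at h
  linarith [Real.exp_pos (-ρ 1)]

theorem continuousOn_T (i : A) : ContinuousOn M.T (M.V i) := (M.T_C1 i).continuousOn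

theorem strictMonoOn_or_strictAntiOn_T (i : A) :
    StrictMonoOn M.T (M.V i) ∨ StrictAntiOn M.T (M.V i) := by
  have hconv : Convex ℝ (M.V i) := (M.V_ordConnected i).convex
  have hderiv : ∀ x ∈ interior (M.V i),
      HasDerivWithinAt M.T (M.T' x) (interior (M.V i)) x := fun x hx =>
    (M.T_hasDeriv i x (interior_subset hx)).mono interior_subset
  rcases hasDerivWithinAt_forall_lt_or_forall_gt_of_forall_ne hconv (M.T_hasDeriv i)
    (fun x hx => M.deriv_ne_zero i hx) with h | h
  · exact Or.inr (strictAntiOn_of_hasDerivWithinAt_neg hconv (M.continuousOn_T i) hderiv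
      fun x hx => h x (interior_subset hx))
  · exact Or.inl (strictMonoOn_of_hasDerivWithinAt_pos hconv (M.continuousOn_T i) hderiv
      fun x hx => h x (interior_subset hx))

theorem interior_V_subset (i : A) : interior (M.V i) ⊆ Ioo (0 : ℝ) 1 := by
  simpa using interior_mono (M.V_subset i)

/-- Every point of `(0,1)` has a preimage in the interior of each `V i`. -/
theorem exists_preimage (i : A) {y : ℝ} (hy : y ∈ Ioo (0 : ℝ) 1) :
    ∃ x ∈ interior (M.V i), M.T x = y := by
  rw [← M.T_maps_interior i] at hy
  exact hy

/-- Two of the branches are separated by a point of `(0,1)`. -/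
theorem exists_separating_point :
    ∃ i j : A, ∃ b ∈ Ioo (0 : ℝ) 1, (∀ x ∈ interior (M.V i), x < b) ∧
      ∀ x ∈ interior (M.V j), b < x := by
  have key : ∀ i j : A, i ≠ j → ∀ u ∈ interior (M.V i), ∀ v ∈ interior (M.V j), u < v →
      ∃ b ∈ Ioo (0 : ℝ) 1, (∀ x ∈ interior (M.V i), x < b) ∧ ∀ x ∈ interior (M.V j), b < x := by
    intro i j hij u hu v hv huv
    have hlt : ∀ x ∈ interior (M.V i), ∀ y ∈ interior (M.V j), x < y := by
      have hd := Set.disjoint_left.1 (M.V_disjoint hij)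
      intro x hx y hy
      have hx' := interior_subset hx
      have hy' := interior_subset hy
      have hu' := interior_subset hu
      have hv' := interior_subset hv
      by_contra! hyx
      rcases le_total y u with h | h
      · exact hd hu' ((M.V_ordConnected j).out hy' hv' ⟨h, huv.le⟩)
      · exact hd ((M.V_ordConnected i).out hu' hx' ⟨h, hyx⟩) hy'
    have hbdd : BddAbove (interior (M.V i)) := ⟨v, fun x hx => (hlt x hx v hv).le⟩
    have hne : (interior (M.V i)).Nonempty := ⟨u, hu⟩
    have hlt1 : ∀ x ∈ interior (M.V i), x < sSup (interior (M.V i)) := by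
      intro x hx
      have hmem : interior (M.V i) ∈ 𝓝[>] x :=
        mem_nhdsWithin_of_mem_nhds (isOpen_interior.mem_nhds hx)
      obtain ⟨z, hz, hxz⟩ := Filter.nonempty_of_mem (inter_mem hmem self_mem_nhdsWithin)
      exact lt_of_lt_of_le hxz (le_csSup hbdd hz)
    have hlt2 : ∀ x ∈ interior (M.V j), sSup (interior (M.V i)) < x := by
      intro x hx
      have hmem : interior (M.V j) ∈ 𝓝[<] x :=
        mem_nhdsWithin_of_mem_nhds (isOpen_interior.mem_nhds hx)
      obtain ⟨z, hz, hxz⟩ := Filter.nonempty_of_mem (inter_mem hmem self_mem_nhdsWithin)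
      exact lt_of_le_of_lt (csSup_le hne fun y hy => (hlt y hy z hz).le) hxz
    exact ⟨_, ⟨(M.interior_V_subset i hu).1.trans (hlt1 u hu),
      (hlt2 v hv).trans (M.interior_V_subset j hv).2⟩, hlt1, hlt2⟩
  obtain ⟨i, j, hij⟩ := M.nontriv
  obtain ⟨u, hu⟩ := M.V_interior_nonempty i
  obtain ⟨v, hv⟩ := M.V_interior_nonempty j
  have huv : u ≠ v := fun h =>
    Set.disjoint_left.1 (M.V_disjoint hij) (interior_subset hu) (h ▸ interior_subset hv)
  rcases huv.lt_or_gt with h | h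
  · exact ⟨i, j, key i j hij u hu v hv h⟩
  · exact ⟨j, i, key j i hij.symm v hv u hu h⟩

/-- The interior of the set of points of `V i` sent into `V k` is an interval. -/
theorem ordConnected_interior_inter_preimage (i k : A) :
    (interior (M.V i) ∩ M.T ⁻¹' interior (M.V k)).OrdConnected := by
  have hi := (M.V_ordConnected i).interior
  have hk := (M.V_ordConnected k).interior
  refine ⟨fun x hx y hy z hz => ?_⟩
  have hzi := hi.out hx.1 hy.1 hz
  refine ⟨hzi, ?_⟩
  have hz' := interior_subset hzi
  have hx' := interior_subset hx.1
  have hy' := interior_subset hy.1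
  rcases M.strictMonoOn_or_strictAntiOn_T i with h | h
  · exact hk.out hx.2 hy.2 ⟨h.monotoneOn hx' hz' hz.1, h.monotoneOn hz' hy' hz.2⟩
  · exact hk.out hy.2 hx.2 ⟨h.antitoneOn hz' hy' hz.2, h.antitoneOn hx' hz' hz.1⟩

/-- There is a point of period two lying, with its image, in the interiors of the branches. -/
theorem exists_periodic_point :
    ∃ i k : A, ∃ p ∈ interior (M.V i), M.T p ∈ interior (M.V k) ∧ M.T (M.T p) = p := by
  obtain ⟨i, j, b, hb, hib, hjb⟩ := M.exists_separating_point
  obtain ⟨q, hq, hqb⟩ := M.exists_preimage i hb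
  obtain ⟨k, hk⟩ : ∃ k : A, ∀ x ∈ interior (M.V i), M.T x ∈ interior (M.V k) → q < x := by
    rcases M.strictMonoOn_or_strictAntiOn_T i with h | h
    · refine ⟨j, fun x hx hTx => ?_⟩
      exact (h.lt_iff_lt (interior_subset hq) (interior_subset hx)).1 (hqb ▸ hjb _ hTx)
    · refine ⟨i, fun x hx hTx => ?_⟩
      exact (h.lt_iff_gt (interior_subset hx) (interior_subset hq)).1 (hqb ▸ hib _ hTx)
  set U := interior (M.V i) ∩ M.T ⁻¹' interior (M.V k) with hU
  have hsurj : ∀ y ∈ Ioo (0 : ℝ) 1, ∃ x ∈ U, M.T (M.T x) = y := by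
    intro y hy
    obtain ⟨z, hz, hzy⟩ := M.exists_preimage k hy
    obtain ⟨x, hx, hxz⟩ := M.exists_preimage i (M.interior_V_subset k hz)
    exact ⟨x, ⟨hx, by simpa [hxz] using hz⟩, by rw [hxz, hzy]⟩
  have hcont : ContinuousOn (fun x => M.T (M.T x)) U :=
    (M.continuousOn_T k).comp ((M.continuousOn_T i).mono
      (inter_subset_left.trans interior_subset)) fun x hx => interior_subset hx.2
  have hq01 := M.interior_V_subset i hq
  obtain ⟨x, hx, hxq⟩ := hsurj q hq01
  obtain ⟨y, hy, hyb⟩ := hsurj b hb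
  obtain ⟨p, hp, hpp⟩ :=
    (M.ordConnected_interior_inter_preimage i k).isPreconnected.intermediate_value₂ hx hy
      hcont continuousOn_id (by simpa [hxq] using (hk x hx.1 hx.2).le)
      (by simpa [hyb] using (hib y hy.1).le)
  exact ⟨i, k, p, hp.1, hp.2, hpp⟩

theorem mem_repeller_of_image {x : ℝ} {i : A} (hx : x ∈ M.V i) (hTx : M.T x ∈ M.repeller) :
    x ∈ M.repeller := by
  intro n
  cases n with
  | zero => exact mem_iUnion.2 ⟨i, hx⟩
  | succ n => exact hTx n

theorem iterate_mem_repeller {x : ℝ} (hx : x ∈ M.repeller) (l : ℕ) :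
    M.T^[l] x ∈ M.repeller := fun n => by
  rw [← Function.iterate_add_apply]
  exact hx (n + l)

/-- Every cylinder meets the repeller. -/
theorem exists_mem_cylinder_inter_repeller {n : ℕ} (ω : Fin n → A) :
    ∃ x ∈ M.cylinder ω ∩ M.repeller, x ∈ Ioo (0 : ℝ) 1 := by
  induction n with
  | zero =>
    obtain ⟨i, k, p, hp, hTp, hpp⟩ := M.exists_periodic_point
    refine ⟨p, ⟨fun ν => ν.elim0, fun n => ?_⟩, M.interior_V_subset i hp⟩
    have h2 : M.T^[2] p = p := hpp
    rcases Nat.even_or_odd' n with ⟨m, rfl | rfl⟩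
    · rw [Function.iterate_mul, Function.iterate_fixed h2]
      exact mem_iUnion.2 ⟨i, interior_subset hp⟩
    · rw [Function.iterate_succ_apply', Function.iterate_mul, Function.iterate_fixed h2]
      exact mem_iUnion.2 ⟨k, interior_subset hTp⟩
  | succ n ih =>
    obtain ⟨y, ⟨hyω, hyr⟩, hy⟩ := ih (Fin.tail ω)
    obtain ⟨x, hx, rfl⟩ := M.exists_preimage (ω 0) hy
    refine ⟨x, ⟨fun ν => ?_, M.mem_repeller_of_image (interior_subset hx) hyr⟩,
      M.interior_V_subset _ hx⟩
    refine Fin.cases ?_ (fun μ => ?_) ν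
    · exact interior_subset hx
    · exact hyω μ

variable {M} {f : ℝ → ℝ}

theorem Tempered.bddAbove_varSet (hf : M.Tempered f) (n : ℕ) :
    BddAbove (M.varSet (M.birkhoff f n) n) := by
  obtain ⟨B, hB⟩ := hf.1
  refine ⟨n * B, ?_⟩
  rintro d ⟨ω, x, hx, y, hy, rfl⟩
  calc |M.birkhoff f n x - M.birkhoff f n y|
      = |∑ l ∈ Finset.range n, (f (M.T^[l] x) - f (M.T^[l] y))| := by
        rw [birkhoff, birkhoff, Finset.sum_sub_distrib]
    _ ≤ ∑ l ∈ Finset.range n, |f (M.T^[l] x) - f (M.T^[l] y)| := Finset.abs_sum_le_sum_abs _ _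
    _ ≤ ∑ _l ∈ Finset.range n, B := by
        refine Finset.sum_le_sum fun l hl => hB ?_
        have hl' := Finset.mem_range.1 hl
        exact ⟨fun _ => ω ⟨l, hl'⟩,
          M.T^[l] x, ⟨by simpa [cylinder] using hx.1 ⟨l, hl'⟩, M.iterate_mem_repeller hx.2 l⟩,
          M.T^[l] y, ⟨by simpa [cylinder] using hy.1 ⟨l, hl'⟩, M.iterate_mem_repeller hy.2 l⟩, rfl⟩
    _ = n * B := by simp

theorem Tempered.birkhoff_le_add_var (hf : M.Tempered f) {n : ℕ} {ω : Fin n → A} {x y : ℝ}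
    (hx : x ∈ M.cylinder ω ∩ M.repeller) (hy : y ∈ M.cylinder ω ∩ M.repeller) :
    M.birkhoff f n x ≤ M.birkhoff f n y + M.var (M.birkhoff f n) n := by
  have h : |M.birkhoff f n x - M.birkhoff f n y| ≤ M.var (M.birkhoff f n) n :=
    le_csSup (hf.bddAbove_varSet n) ⟨ω, x, hx, y, hy, rfl⟩
  linarith [le_abs_self (M.birkhoff f n x - M.birkhoff f n y)]

theorem Tempered.birkhoffSup_le (hf : M.Tempered f) {n : ℕ} {ω : Fin n → A} {y : ℝ}
    (hy : y ∈ M.cylinder ω ∩ M.repeller) :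
    M.birkhoffSup f ω ≤ M.birkhoff f n y + M.var (M.birkhoff f n) n := by
  refine csSup_le ⟨_, y, hy, rfl⟩ ?_
  rintro v ⟨x, hx, rfl⟩
  exact hf.birkhoff_le_add_var hx hy

theorem Tempered.le_birkhoffSup (hf : M.Tempered f) {n : ℕ} {ω : Fin n → A} {y : ℝ}
    (hy : y ∈ M.cylinder ω ∩ M.repeller) :
    M.birkhoff f n y ≤ M.birkhoffSup f ω := by
  refine le_csSup ⟨M.birkhoff f n y + M.var (M.birkhoff f n) n, ?_⟩ ⟨y, hy, rfl⟩
  rintro v ⟨x, hx, rfl⟩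
  exact hf.birkhoff_le_add_var hx hy

variable (M f) in
theorem birkhoff_mul (k n : ℕ) (x : ℝ) :
    M.birkhoff f (k * n) x = ∑ i : Fin k, M.birkhoff f n (M.T^[n * i] x) := by
  rw [Fin.sum_univ_eq_sum_range (fun i => M.birkhoff f n (M.T^[n * i] x)) k]
  induction k with
  | zero => simp [birkhoff]
  | succ k ih =>
    rw [Finset.sum_range_succ, ← ih, add_mul, one_mul, birkhoff, Finset.sum_range_add]
    simp only [birkhoff, ← Function.iterate_add_apply, add_comm, mul_comm]

/-- Words of length `k * n` as `k`-tuples of words of length `n`. -/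
def concatEquiv (B : Type) (k n : ℕ) : (Fin k → Fin n → B) ≃ (Fin (k * n) → B) :=
  (Equiv.curry (Fin k) (Fin n) B).symm.trans (Equiv.arrowCongr finProdFinEquiv (Equiv.refl B))

theorem concatEquiv_apply {B : Type} {k n : ℕ} (τ : Fin k → Fin n → B) (i : Fin k) (j : Fin n) :
    concatEquiv B k n τ (finProdFinEquiv (i, j)) = τ i j := by
  simp [concatEquiv]

theorem Tempered.sum_birkhoffSup_sub_var_le (hf : M.Tempered f) {k n : ℕ}
    (ω : Fin (k * n) → A) :
    ∑ i : Fin k, (M.birkhoffSup f (fun j : Fin n => ω (finProdFinEquiv (i, j))) -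
      M.var (M.birkhoff f n) n) ≤ M.birkhoffSup f ω := by
  obtain ⟨x, hx, -⟩ := M.exists_mem_cylinder_inter_repeller ω
  refine le_trans ?_ (hf.le_birkhoffSup hx)
  rw [birkhoff_mul]
  refine Finset.sum_le_sum fun i _ => ?_
  rw [sub_le_iff_le_add]
  refine hf.birkhoffSup_le ⟨fun j => ?_, M.iterate_mem_repeller hx.2 _⟩
  rw [← Function.iterate_add_apply]
  exact hx.1 (finProdFinEquiv (i, j))

/-- Supermultiplicativity, up to distortion, of the partition function of a subsystem. -/
theorem Tempered.pow_partition_le (hf : M.Tempered f) (F : Finset A) (k n : ℕ) :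
    (ENNReal.ofReal (Real.exp (-M.var (M.birkhoff f n) n)) *
      ∑' ω : Fin n → F, ENNReal.ofReal (Real.exp (M.birkhoffSup f fun ν => (ω ν : A)))) ^ k ≤
    ∑' ω : Fin (k * n) → F, ENNReal.ofReal (Real.exp (M.birkhoffSup f fun ν => (ω ν : A))) := by
  classical
  rw [tsum_fintype, tsum_fintype, Finset.mul_sum, Fintype.sum_pow,
    ← (concatEquiv F k n).sum_comp]
  refine Finset.sum_le_sum fun τ _ => ?_
  simp only [← ENNReal.ofReal_mul (Real.exp_pos _).le, ← Real.exp_add]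
  rw [← ENNReal.ofReal_prod_of_nonneg fun i _ => (Real.exp_pos _).le, ← Real.exp_sum]
  refine ENNReal.ofReal_le_ofReal (Real.exp_le_exp.2 ?_)
  have h := hf.sum_birkhoffSup_sub_var_le (fun ν => (concatEquiv F k n τ ν : A))
  simpa only [concatEquiv_apply, neg_add_eq_sub] using h

variable (M f) in
theorem pressureOn_le_pressure (F : Finset A) : M.pressureOn F f ≤ M.pressure f := by
  refine limsup_le_limsup (Eventually.of_forall fun n => ?_)
  refine mul_le_mul_of_nonneg_left (ENNReal.log_monotone ?_)
    (EReal.coe_nonneg.2 (by positivity))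
  exact ENNReal.tsum_comp_le_tsum_of_injective
    (f := fun (ω : Fin n → F) ν => (ω ν : A))
    (fun ω τ h => funext fun ν => Subtype.ext (congrFun h ν)) _

variable (M f) in
/-- A partition function exceeding `c` already does so over a finite alphabet. -/
theorem exists_finset_lt_partition {n : ℕ} {c : ENNReal}
    (h : c < ∑' ω : Fin n → A, ENNReal.ofReal (Real.exp (M.birkhoffSup f ω))) :
    ∃ F : Finset A, c < ∑' ω : Fin n → F,
      ENNReal.ofReal (Real.exp (M.birkhoffSup f fun ν => (ω ν : A))) := by
  classical
  rw [ENNReal.tsum_eq_iSup_sum] at h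
  obtain ⟨E, hE⟩ := lt_iSup_iff.1 h
  let F : Finset A := E.biUnion fun ω => Finset.univ.image ω
  have hF : ∀ ω ∈ E, ∀ ν, ω ν ∈ F := fun ω hω ν =>
    Finset.mem_biUnion.2 ⟨ω, hω, Finset.mem_image_of_mem ω (Finset.mem_univ ν)⟩
  refine ⟨F, hE.trans_le ?_⟩
  rw [← Finset.tsum_subtype]
  exact ENNReal.tsum_comp_le_tsum_of_injective
    (f := fun (ω : E) ν => (⟨ω.1 ν, hF ω.1 ω.2 ν⟩ : F))
    (fun ω τ h => Subtype.ext (funext fun ν => congrArg Subtype.val (congrFun h ν)))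
    fun ω : Fin n → F => ENNReal.ofReal (Real.exp (M.birkhoffSup f fun ν => (ω ν : A)))

end ExpandingMarkovMap

theorem ENNReal.log_ofReal_exp (t : ℝ) : ENNReal.log (ENNReal.ofReal (Real.exp t)) = t := by
  rw [ENNReal.log_ofReal_of_pos (Real.exp_pos t), Real.log_exp]

theorem EReal.coe_le_one_div_mul_log_iff {n : ℕ} (hn : n ≠ 0) (c : ℝ) (z : ENNReal) :
    (c : EReal) ≤ ((1 / (n : ℝ) : ℝ) : EReal) * ENNReal.log z ↔
      ENNReal.ofReal (Real.exp (n * c)) ≤ z := by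
  have hn' : (0 : ℝ) < n := by positivity
  have hn1 : (0 : ℝ) < 1 / n := by positivity
  rw [← ENNReal.log_le_log_iff, ENNReal.log_ofReal_exp]
  induction ENNReal.log z with
  | bot => rw [EReal.coe_mul_bot_of_pos hn1, le_bot_iff, le_bot_iff]; simp only [EReal.coe_ne_bot]
  | top => rw [EReal.coe_mul_top_of_pos hn1]; simp only [le_top]
  | coe a =>
    rw [← EReal.coe_mul, EReal.coe_le_coe_iff, EReal.coe_le_coe_iff, one_div_mul_eq_div,
      le_div_iff₀' hn']

theorem EReal.coe_lt_one_div_mul_log_iff {n : ℕ} (hn : n ≠ 0) (c : ℝ) (z : ENNReal) :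
    (c : EReal) < ((1 / (n : ℝ) : ℝ) : EReal) * ENNReal.log z ↔
      ENNReal.ofReal (Real.exp (n * c)) < z := by
  have hn' : (0 : ℝ) < n := by positivity
  have hn1 : (0 : ℝ) < 1 / n := by positivity
  rw [← ENNReal.log_lt_log_iff, ENNReal.log_ofReal_exp]
  induction ENNReal.log z with
  | bot => rw [EReal.coe_mul_bot_of_pos hn1]; simp only [not_lt_bot]
  | top => rw [EReal.coe_mul_top_of_pos hn1]; simp only [EReal.coe_lt_top]
  | coe a =>
    rw [← EReal.coe_mul, EReal.coe_lt_coe_iff, EReal.coe_lt_coe_iff, one_div_mul_eq_div,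
      lt_div_iff₀' hn']

/-- **Finite approximation property of the pressure.** For a potential `f` satisfying the
tempered distortion condition, `P(f) = sup { P_F(f) : F ⊆ A finite }`. -/
theorem pressure_eq_iSup_pressureOn {A : Type} (M : ExpandingMarkovMap A)
    (f : ℝ → ℝ) (hf : M.Tempered f) :
    M.pressure f = sSup {p : EReal | ∃ F : Finset A, p = M.pressureOn F f} := by
  refine le_antisymm ?_ (sSup_le ?_)
  · by_contra! hlt
    obtain ⟨c, hc, hcP⟩ := EReal.lt_iff_exists_real_btwn.1 hlt
    obtain ⟨c', hcc', hc'P⟩ := EReal.lt_iff_exists_real_btwn.1 hcP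
    have hε : 0 < c' - c := sub_pos.2 (EReal.coe_lt_coe_iff.1 hcc')
    have hvar := hf.2.eventually_lt_const hε
    obtain ⟨n, hn, hv, hn0⟩ := ((frequently_lt_of_lt_limsup (by isBoundedDefault)
      hc'P).and_eventually (hvar.and (eventually_ne_atTop 0))).exists
    rw [EReal.coe_lt_one_div_mul_log_iff hn0] at hn
    obtain ⟨F, hF⟩ := M.exists_finset_lt_partition f hn
    refine hc.not_ge (le_trans ?_ (le_sSup ⟨F, rfl⟩))
    have hn' : (0 : ℝ) < n := by positivity
    rw [div_lt_iff₀ hn'] at hv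
    have hmain : ∀ k : ℕ, k ≠ 0 → (c : EReal) ≤ ((1 / ((k * n : ℕ) : ℝ) : ℝ) : EReal) *
        ENNReal.log (∑' ω : Fin (k * n) → F, ENNReal.ofReal
          (Real.exp (M.birkhoffSup f fun ν => (ω ν : A)))) := by
      intro k hk
      rw [EReal.coe_le_one_div_mul_log_iff (mul_ne_zero hk hn0)]
      refine le_trans ?_ (hf.pow_partition_le F k n)
      calc ENNReal.ofReal (Real.exp ((k * n : ℕ) * c))
          = ENNReal.ofReal (Real.exp (n * c)) ^ k := by
            rw [← ENNReal.ofReal_pow (Real.exp_pos _).le, ← Real.exp_nat_mul]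
            push_cast
            ring_nf
        _ ≤ _ := by
            refine pow_le_pow_left₀ zero_le ?_ k
            calc ENNReal.ofReal (Real.exp (n * c))
                ≤ ENNReal.ofReal (Real.exp (-M.var (M.birkhoff f n) n)) *
                    ENNReal.ofReal (Real.exp (n * c')) := by
                  rw [← ENNReal.ofReal_mul (Real.exp_pos _).le, ← Real.exp_add]
                  exact ENNReal.ofReal_le_ofReal (Real.exp_le_exp.2 (by linarith))
              _ ≤ _ := mul_le_mul_right hF.le _
    refine le_limsup_of_frequently_le ?_ (by isBoundedDefault)
    refine frequently_atTop.2 fun a => ⟨(a + 1) * n, ?_, hmain (a + 1) a.succ_ne_zero⟩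
    nlinarith [Nat.pos_of_ne_zero hn0]
  · rintro p ⟨F, rfl⟩
    exact M.pressureOn_le_pressure f F
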